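/- Let M be a pointwise finite-dimensional, weakly exact, indecomposable persistence module over the finite grid [1,n] × [1,m] that is not isomorphic to a rectangle module. Then the structure map ρ_{(1,1)}^{(n,m)} : M_{(1,1)} → M_{(n,m)} is the zero map. -/

import Mathlib

open CategoryTheory Limits Set

noncomputable section

set_option linter.unusedSectionVars false

attribute [local instance] Classical.propDecidable

namespace PersistencePaper

/-- A persistence module over a poset `P`, with coefficients in a field `k`:
a functor from `P` (viewed as a category) to the category of `k`-vector spaces. -/
abbrev PersistenceModule (k : Type) [Field k] (P : Type) [Preorder P] : Type 1 :=
  P ⥤ ModuleCat k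

variable (k : Type) [Field k]

section Indicator

variable {P : Type} [Preorder P]

/-- The fiber of the indicator module of a set `Q ⊆ P` at a point `t : P`,
realized as a submodule of `k`: it is all of `k` when `t ∈ Q` and `0` otherwise. -/
def indSub (Q : Set P) (t : P) : Submodule k k where
  carrier := {x | t ∉ Q → x = 0}
  add_mem' := by intro a b ha hb ht; rw [ha ht, hb ht, add_zero]
  zero_mem' := fun _ => rfl
  smul_mem' := by intro c x hx ht; rw [hx ht, smul_zero]

/-- The structure map of the indicator module: the identity when both endpoints lie in
`Q`, and zero otherwise. -/
def indMap (Q : Set P) (s t : P) : indSub k Q s →ₗ[k] indSub k Q t where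
  toFun x := ⟨if s ∈ Q ∧ t ∈ Q then (x : k) else 0, by
    intro ht
    split_ifs with h
    · exact absurd h.2 ht
    · rfl⟩
  map_add' x y := by apply Subtype.ext; split_ifs <;> simp
  map_smul' c x := by apply Subtype.ext; split_ifs <;> simp

theorem indMap_coe (Q : Set P) (s t : P) (x : indSub k Q s) :
    (indMap k Q s t x : k) = if s ∈ Q ∧ t ∈ Q then (x : k) else 0 := rfl

/-- The indicator persistence module `k_Q` of a convex subset `Q` of a poset `P`:
it assigns `k` to points of `Q` and `0` elsewhere, the structure maps being the identity
between points of `Q` and zero otherwise. -/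
def indicator (Q : Set P) (hQ : Q.OrdConnected) : PersistenceModule k P where
  obj t := ModuleCat.of k (indSub k Q t)
  map {s t} _ := ModuleCat.ofHom (indMap k Q s t)
  map_id t := by
    refine ModuleCat.hom_ext <| LinearMap.ext fun x => Subtype.ext ?_
    show (indMap k Q t t x).val = Subtype.val x
    rw [indMap_coe]
    split_ifs with h
    · rfl
    · exact (x.2 fun ht => h ⟨ht, ht⟩).symm
  map_comp {s t u} f g := by
    refine ModuleCat.hom_ext <| LinearMap.ext fun x => Subtype.ext ?_
    show (indMap k Q s u x).val = (indMap k Q t u (indMap k Q s t x)).val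
    rw [indMap_coe, indMap_coe, indMap_coe]
    by_cases hs : s ∈ Q <;> by_cases hu : u ∈ Q
    · have ht : t ∈ Q := hQ.out hs hu ⟨leOfHom f, leOfHom g⟩
      simp [hs, ht, hu]
    · simp [hs, hu]
    · simp [hs, hu]
    · simp [hs, hu]

/-- The structure map `ρ_s^t : M_s → M_t` of a persistence module, as a linear map. -/
def rho (M : PersistenceModule k P) {s t : P} (h : s ≤ t) : M.obj s →ₗ[k] M.obj t :=
  (M.map (homOfLE h)).hom

/-- The rank invariant `r(s,t)` of a persistence module: the rank of `ρ_s^t` when `s ≤ t`,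
and `0` (by convention) otherwise. -/
def rk (M : PersistenceModule k P) (s t : P) : ℕ :=
  if h : s ≤ t then Module.finrank k (LinearMap.range (rho k M h)) else 0

/-- A persistence module is pointwise finite-dimensional (pfd) if all its spaces are
finite-dimensional. -/
def Pfd (M : PersistenceModule k P) : Prop :=
  ∀ t : P, FiniteDimensional k (M.obj t)

/-- An interval of a poset: a nonempty, convex and zigzag-connected subset. -/
def IsInterval (Q : Set P) : Prop :=
  Q.Nonempty ∧ Q.OrdConnected ∧
    ∀ p ∈ Q, ∀ q ∈ Q,
      Relation.ReflTransGen (fun a b => a ∈ Q ∧ b ∈ Q ∧ (a ≤ b ∨ b ≤ a)) p q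

/-- A persistence module is interval-decomposable if it is isomorphic to a direct sum
of indicator modules of intervals. -/
def IntervalDecomposable (M : PersistenceModule k P) : Prop :=
  ∃ (ι : Type) (I : ι → Set P) (hI : ∀ i, IsInterval (I i)),
    Nonempty (M ≅ ∐ fun i => indicator k (I i) (hI i).2.1)

end Indicator

section Rect

variable {X Y : Type} [Preorder X] [Preorder Y]

/-- A rectangle in the product poset `X × Y`: a nonempty product `I ×ˢ J` of an
interval (convex subset) of `X` with an interval of `Y`. -/
def IsRectangle (R : Set (X × Y)) : Prop :=
  R.Nonempty ∧ ∃ (I : Set X) (J : Set Y), I.OrdConnected ∧ J.OrdConnected ∧ R = I ×ˢ J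

theorem IsRectangle.ordConnected {R : Set (X × Y)} (h : IsRectangle R) :
    R.OrdConnected := by
  obtain ⟨-, I, J, hI, hJ, rfl⟩ := h
  constructor
  intro x hx y hy z hz
  exact ⟨hI.out hx.1 hy.1 ⟨hz.1.1, hz.2.1⟩, hJ.out hx.2 hy.2 ⟨hz.1.2, hz.2.2⟩⟩

/-- A persistence bimodule is rectangle-decomposable if it is isomorphic to a direct sum
of indicator (rectangle) modules of rectangles. -/
def RectangleDecomposable (M : PersistenceModule k (X × Y)) : Prop :=
  ∃ (ι : Type) (R : ι → Set (X × Y)) (hR : ∀ i, IsRectangle (R i)),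
    Nonempty (M ≅ ∐ fun i => indicator k (R i) (hR i).ordConnected)

/-- A persistence bimodule `M` over `X × Y` is weakly exact if for all `s ≤ t`,
`Im ρ_s^t = Im ρ_{(t₁,s₂)}^t ∩ Im ρ_{(s₁,t₂)}^t` and
`Ker ρ_s^t = Ker ρ_s^{(t₁,s₂)} + Ker ρ_s^{(s₁,t₂)}`. -/
def WeaklyExact (M : PersistenceModule k (X × Y)) : Prop :=
  ∀ (s t : X × Y) (h : s ≤ t),
    (LinearMap.range (rho k M h) =
        LinearMap.range (rho k M (show (t.1, s.2) ≤ t from ⟨le_refl t.1, h.2⟩)) ⊓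
        LinearMap.range (rho k M (show (s.1, t.2) ≤ t from ⟨h.1, le_refl t.2⟩))) ∧
    (LinearMap.ker (rho k M h) =
        LinearMap.ker (rho k M (show s ≤ (t.1, s.2) from ⟨h.1, le_refl s.2⟩)) ⊔
        LinearMap.ker (rho k M (show s ≤ (s.1, t.2) from ⟨le_refl s.1, h.2⟩)))

/-- The space (fiber) of a persistence module at an index. -/
abbrev fiber {k : Type} [Field k] {P : Type} [Preorder P]
    (M : PersistenceModule k P) (t : P) : ModuleCat k :=
  M.obj t

/-- Morphisms of persistence modules (natural transformations). -/
abbrev PMHom {k : Type} [Field k] {P : Type} [Preorder P]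
    (M N : PersistenceModule k P) : Type :=
  M ⟶ N

/-- The component of a morphism of persistence modules at an index, as a linear map. -/
abbrev PMHom.appLin {k : Type} [Field k] {P : Type} [Preorder P]
    {M N : PersistenceModule k P} (f : PMHom M N) (t : P) :
    M.obj t →ₗ[k] N.obj t :=
  (f.app t).hom

/-- The restriction of a persistence module to a subset of its indexing poset. -/
def restrict {P : Type} [Preorder P] (M : PersistenceModule k P) (S : Set P) :
    PersistenceModule k ↥S :=
  (show Monotone (Subtype.val : ↥S → P) from fun _ _ h => h).functor ⋙ M

/-- The pullback (restriction) of a persistence module along a monotone map of posets. -/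
def restrictAlong {P R : Type} [Preorder P] [Preorder R] {f : R → P} (hf : Monotone f)
    (M : PersistenceModule k P) : PersistenceModule k R :=
  hf.functor ⋙ M

/-- The right Kan extension of a persistence module along a monotone map of posets. -/
def ranAlong {P R : Type} [Preorder P] [Preorder R] {f : P → R} (hf : Monotone f)
    (M : PersistenceModule k P) : PersistenceModule k R :=
  hf.functor.ran.obj M

/-- `M` decomposes as a direct sum of indicator modules whose supports are drawn from
the family `A` of (convex) subsets of the indexing poset. -/
def DecomposesWithSupports {P : Type} [Preorder P] (M : PersistenceModule k P)
    (A : Set (Set P)) : Prop :=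
  ∃ (ι : Type) (Q : ι → Set P) (_ : ∀ i, Q i ∈ A) (hconv : ∀ i, (Q i).OrdConnected),
    Nonempty (M ≅ ∐ fun i => indicator k (Q i) (hconv i))

end Rect

end PersistencePaper
namespace PersistencePaper

/-- A persistence module is indecomposable if it is nonzero and in any direct sum
decomposition one of the two summands is zero. -/
def Indecomposable {k : Type} [Field k] {P : Type} [Preorder P]
    (M : PersistenceModule k P) : Prop :=
  (¬ ∀ t : P, Subsingleton (M.obj t)) ∧
    ∀ A B : PersistenceModule k P, Nonempty (M ≅ (A ⨿ B : PersistenceModule k P)) →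
      (∀ t : P, Subsingleton (A.obj t)) ∨ (∀ t : P, Subsingleton (B.obj t))

theorem retract_aux (k : Type) [Field k] {P : Type} [Preorder P]
    (M : PersistenceModule k P) (b e : P) (hb : ∀ t, b ≤ t) (he : ∀ t, t ≤ e)
    (hne : rho k M (hb e) ≠ 0) :
    ∃ (i : indicator k (Set.univ : Set P) Set.ordConnected_univ ⟶ M)
      (r : M ⟶ indicator k (Set.univ : Set P) Set.ordConnected_univ), i ≫ r = 𝟙 _ := by
  have hv : ∃ v, rho k M (hb e) v ≠ 0 := by
    by_contra hc
    push Not at hc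
    exact hne (LinearMap.ext hc)
  obtain ⟨v, hv⟩ := hv
  obtain ⟨φ, hφ⟩ := (show ∃ φ : M.obj e →ₗ[k] k, φ (rho k M (hb e) v) = 1 from by
    obtain ⟨g, hg⟩ := LinearMap.exists_leftInverse_of_injective (LinearMap.toSpanSingleton k _ (rho k M (hb e) v)) (LinearMap.ker_toSpanSingleton k hv)
    exact ⟨g, by simpa using LinearMap.congr_fun hg 1⟩)
  have hcomp : ∀ {s t u : P} (h1 : s ≤ t) (h2 : t ≤ u) (x : M.obj s),
      rho k M h2 (rho k M h1 x) = rho k M (h1.trans h2) x := by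
    intro s t u h1 h2 x
    have : M.map (homOfLE (h1.trans h2)) = M.map (homOfLE h1) ≫ M.map (homOfLE h2) := by
      rw [← M.map_comp]; rfl
    simp only [rho]
    rw [this]
    rfl
  refine ⟨{ app := fun t => ModuleCat.ofHom
              ((LinearMap.toSpanSingleton k (M.obj t) (rho k M (hb t) v)).comp
                (indSub k Set.univ t).subtype)
            naturality := ?_ },
          { app := fun t => ModuleCat.ofHom
              (LinearMap.codRestrict (indSub k Set.univ t) (φ.comp (rho k M (he t)))
                (fun x h => absurd (Set.mem_univ t) h))
            naturality := ?_ }, ?_⟩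
  · intro s t f
    refine ModuleCat.hom_ext <| LinearMap.ext fun x => ?_
    have key : ∀ x : indSub k (Set.univ : Set P) s,
        (indMap k Set.univ s t x).val • rho k M (hb t) v
          = rho k M (leOfHom f) (x.val • rho k M (hb s) v) := by
      intro x
      rw [indMap_coe, map_smul, hcomp]
      simp
    exact key x
  · intro s t f
    refine ModuleCat.hom_ext <| LinearMap.ext fun x => Subtype.ext ?_
    have key : φ (rho k M (he t) (rho k M (leOfHom f) x)) =
        (indMap k (Set.univ : Set P) s t
          ⟨φ (rho k M (he s) x), fun h => absurd (Set.mem_univ s) h⟩).val := by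
      rw [hcomp, indMap_coe]
      simp
    exact key
  · refine NatTrans.ext <| funext fun t => ?_
    refine ModuleCat.hom_ext <| LinearMap.ext fun x => Subtype.ext ?_
    have key : ∀ c : k, φ (rho k M (he t) (c • rho k M (hb t) v)) = c := by
      intro c
      rw [map_smul, hcomp, map_smul, hφ]
      simp
    exact key _

theorem iso_aux {k : Type} [Field k] {P : Type} [Preorder P]
    {M A : PersistenceModule k P} (hM : Indecomposable M) (i : A ⟶ M) (r : M ⟶ A)
    (hir : i ≫ r = 𝟙 _) (hA : ¬ ∀ t : P, Subsingleton (A.obj t)) : Nonempty (M ≅ A) := by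
  haveI : IsSplitMono i := ⟨⟨⟨r, hir⟩⟩⟩
  have hbl := isBilimitBinaryBiconeOfIsSplitMonoOfCokernel (cokernelIsCokernel i)
  have hiso : M ≅ (A ⨿ cokernel i : PersistenceModule k P) :=
    hbl.isColimit.coconePointUniqueUpToIso (colimit.isColimit (pair A (cokernel i)))
  have hB := (hM.2 A (cokernel i) ⟨hiso⟩).resolve_left hA
  have hz : cokernel.π i = 0 := by
    ext t x
    exact (hB t).elim _ _
  haveI : Epi i := Preadditive.epi_of_cokernel_zero hz
  haveI : IsIso i := isIso_of_epi_of_isSplitMono i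
  exact ⟨(asIso i).symm⟩

/-- If `M` is a pfd, weakly exact, indecomposable persistence module
over the grid `[1,n] × [1,m]` which is not isomorphic to a rectangle module, then the
structure map from the bottom-left corner to the top-right corner is zero. -/
theorem structure_map_corner_to_corner_eq_zero (k : Type) [Field k]
    (n m : ℕ) (hn : 0 < n) (hm : 0 < m)
    (M : PersistenceModule k (Fin n × Fin m)) (hpfd : Pfd k M)
    (hwe : WeaklyExact k M) (hindec : Indecomposable M)
    (hnotrect : ∀ (R : Set (Fin n × Fin m)) (hR : IsRectangle R),
      IsEmpty (M ≅ indicator k R hR.ordConnected)) :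
    rho k M
      (show ((⟨0, hn⟩ : Fin n), (⟨0, hm⟩ : Fin m)) ≤
          ((⟨n - 1, by omega⟩ : Fin n), (⟨m - 1, by omega⟩ : Fin m)) from
        ⟨Fin.mk_le_mk.mpr (Nat.zero_le _), Fin.mk_le_mk.mpr (Nat.zero_le _)⟩) = 0 := by
  by_contra hne
  have hb : ∀ t : Fin n × Fin m, ((⟨0, hn⟩ : Fin n), (⟨0, hm⟩ : Fin m)) ≤ t :=
    fun t => ⟨Fin.mk_le_mk.mpr (Nat.zero_le _), Fin.mk_le_mk.mpr (Nat.zero_le _)⟩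
  have he : ∀ t : Fin n × Fin m,
      t ≤ ((⟨n - 1, by omega⟩ : Fin n), (⟨m - 1, by omega⟩ : Fin m)) := by
    intro t
    have h1 := t.1.2
    have h2 := t.2.2
    exact ⟨Fin.le_def.mpr (by simp only; omega), Fin.le_def.mpr (by simp only; omega)⟩
  obtain ⟨i, r, hir⟩ := retract_aux k M _ _ hb he hne
  have hR : IsRectangle (Set.univ : Set (Fin n × Fin m)) :=
    ⟨⟨(⟨0, hn⟩, ⟨0, hm⟩), Set.mem_univ _⟩, Set.univ, Set.univ, Set.ordConnected_univ,
      Set.ordConnected_univ, Set.univ_prod_univ.symm⟩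
  obtain ⟨e⟩ := iso_aux hindec i r hir (by
    intro h
    have h0 := h (⟨0, hn⟩, ⟨0, hm⟩)
    have h1 : (⟨1, fun h => absurd (Set.mem_univ _) h⟩ :
        indSub k (Set.univ : Set (Fin n × Fin m)) (⟨0, hn⟩, ⟨0, hm⟩)) = 0 :=
      h0.elim _ _
    exact one_ne_zero (congrArg Subtype.val h1))
  exact (hnotrect Set.univ hR).false e

end PersistencePaper
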